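/- Let P ⊆ ℕ. There exists a point y in the spacing shift Σ_P with d*(y) > 0 (the support A_y has positive upper Banach density) if and only if the topological entropy h_{σ_P} is positive. -/

import Mathlib

open Filter Topology

/-- The spacing shift `Σ_P ⊆ {0,1}^ℕ` determined by `P ⊆ ℕ`: a `0`-`1` sequence `x`
(encoded as `x : ℕ → Bool`) belongs to `Σ_P` iff whenever two coordinates are `1`,
the (positive) distance between them lies in `P`. -/
def SpacingShift (P : Set ℕ) : Set (ℕ → Bool) :=
  {x | ∀ i j : ℕ, i < j → x i = true → x j = true → j - i ∈ P}

/-- The left shift map `σ` on sequences. -/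
def shift (x : ℕ → Bool) : ℕ → Bool := fun n => x (n + 1)

/-- The support `A_y = {i : y_i = 1}` of a point of the shift space. -/
def supp (x : ℕ → Bool) : Set ℕ := {i | x i = true}

/-- `A ⊆ ℕ` has density `d`, i.e. `|A ∩ {1,…,n}| / n → d`. -/
def HasDensity (A : Set ℕ) (d : ℝ) : Prop :=
  Tendsto (fun n : ℕ => (Nat.card (A ∩ Set.Icc 1 n : Set ℕ) : ℝ) / n) atTop (𝓝 d)

/-- The upper density `d̄(A) = limsup_n |A ∩ {1,…,n}| / n`. -/
noncomputable def upperDensity (A : Set ℕ) : ℝ :=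
  limsup (fun n : ℕ => (Nat.card (A ∩ Set.Icc 1 n : Set ℕ) : ℝ) / n) atTop

/-- The upper Banach density `d*(A)`: the limsup, as the window length tends to infinity,
of the maximal proportion of elements of `A` in a window of that length. -/
noncomputable def upperBanachDensity (A : Set ℕ) : ℝ :=
  limsup (fun n : ℕ =>
    ⨆ m : ℕ, (Nat.card (A ∩ Set.Icc m (m + n) : Set ℕ) : ℝ) / (n + 1)) atTop

/-- `D ⊆ ℕ` is a Δ-set: it contains the difference set `{s_i - s_j : i > j}` of some
strictly increasing sequence of natural numbers. -/
def IsDeltaSet (D : Set ℕ) : Prop :=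
  ∃ s : ℕ → ℕ, StrictMono s ∧ ∀ i j : ℕ, j < i → s i - s j ∈ D

/-- `D ⊆ ℕ` is a Δ*-set: it meets every Δ-set. -/
def IsDeltaStarSet (D : Set ℕ) : Prop :=
  ∀ D' : Set ℕ, IsDeltaSet D' → (D ∩ D').Nonempty

open Classical in
/-- The standard metric on the shift space: `d(x,y) = 2^{-min{n : x_n ≠ y_n}}`,
and `d(x,x) = 0`. -/
noncomputable def seqDist (x y : ℕ → Bool) : ℝ :=
  if x = y then 0 else (2 : ℝ)⁻¹ ^ sInf {n : ℕ | x n ≠ y n}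

/-- The set `FS((a_n))` of finite sums of a sequence of natural numbers:
all sums `a_{i_1} + ⋯ + a_{i_k}` with `i_1 < ⋯ < i_k`. -/
def FSseq (a : ℕ → ℕ) : Set ℕ :=
  {n | ∃ F : Finset ℕ, F.Nonempty ∧ n = ∑ i ∈ F, a i}

/-- `S ⊆ ℕ` is an IP-set: it contains the finite sums of some sequence of positive
natural numbers. -/
def IsIPSet (S : Set ℕ) : Prop :=
  ∃ a : ℕ → ℕ, (∀ n, 0 < a n) ∧ FSseq a ⊆ S

/-- The set `FS(A)` of finite sums of distinct elements of a set `A ⊆ ℕ`. -/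
def FSset (A : Set ℕ) : Set ℕ :=
  {n | ∃ F : Finset ℕ, ↑F ⊆ A ∧ F.Nonempty ∧ n = ∑ i ∈ F, i}

/-- The spacing shift `(Σ_P, σ_P)` is topologically transitive: some point of `Σ_P`
has forward orbit (under the shift) dense in `Σ_P`. -/
def IsTransitiveShift (P : Set ℕ) : Prop :=
  ∃ x ∈ SpacingShift P, SpacingShift P ⊆ closure {y : ℕ → Bool | ∃ n : ℕ, shift^[n] x = y}

/-- `E ⊆ ℕ` is density intersective: it meets the difference set `A - A` of every set
`A ⊆ ℕ` of positive upper Banach density. -/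
def DensityIntersective (E : Set ℕ) : Prop :=
  ∀ A : Set ℕ, 0 < upperBanachDensity A → ∃ a ∈ A, ∃ a' ∈ A, a' < a ∧ a - a' ∈ E

/-- The positions of the ones among the first `N` coordinates of `x`. -/
def onesBelow (x : ℕ → Bool) (N : ℕ) : Finset ℕ := {i ∈ Finset.range N | x i = true}

lemma mem_onesBelow {x : ℕ → Bool} {N i : ℕ} : i ∈ onesBelow x N ↔ i < N ∧ x i = true := by
  simp [onesBelow]

lemma card_onesBelow_le (x : ℕ → Bool) (N : ℕ) : (onesBelow x N).card ≤ N := by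
  simpa [onesBelow] using Finset.card_filter_le (Finset.range N) (fun i => x i = true)

lemma card_onesBelow_eq_sum (x : ℕ → Bool) (N : ℕ) :
    (onesBelow x N).card = ∑ i ∈ Finset.range N, (x i).toNat := by
  rw [onesBelow, Finset.card_filter]
  refine Finset.sum_congr rfl fun i _ => ?_
  cases x i <;> simp

lemma shift_iterate_apply (x : ℕ → Bool) (m i : ℕ) : shift^[m] x i = x (m + i) := by
  induction m generalizing x with
  | zero => simp
  | succ m ih => rw [Function.iterate_succ_apply, ih, shift]; congr 1; omega

lemma card_onesBelow_add (x : ℕ → Bool) (a b : ℕ) :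
    (onesBelow x (a + b)).card = (onesBelow x a).card + (onesBelow (shift^[a] x) b).card := by
  simp only [card_onesBelow_eq_sum, Finset.sum_range_add, shift_iterate_apply]

lemma continuous_card_onesBelow (N : ℕ) :
    Continuous fun x : ℕ → Bool => (onesBelow x N).card := by
  simp only [card_onesBelow_eq_sum]
  exact continuous_finsetSum _ fun i _ =>
    (continuous_of_discreteTopology (f := Bool.toNat)).comp (continuous_apply i)

lemma card_supp_inter_Icc (x : ℕ → Bool) (m n : ℕ) :
    Nat.card (supp x ∩ Set.Icc m (m + n) : Set ℕ) = (onesBelow (shift^[m] x) (n + 1)).card := by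
  have h : (supp x ∩ Set.Icc m (m + n) : Set ℕ) =
      ((onesBelow (shift^[m] x) (n + 1)).map (addLeftEmbedding m) : Finset ℕ) := by
    ext i
    simp only [supp, Set.mem_inter_iff, Set.mem_ofPred_eq, Set.mem_Icc, Finset.coe_map,
      addLeftEmbedding_apply, Set.mem_image, Finset.mem_coe, mem_onesBelow, shift_iterate_apply]
    constructor
    · rintro ⟨h, h₁, h₂⟩
      exact ⟨i - m, ⟨by omega, by rwa [Nat.add_sub_cancel' h₁]⟩, by omega⟩
    · rintro ⟨j, ⟨h₁, h₂⟩, rfl⟩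
      exact ⟨h₂, by omega, by omega⟩
  rw [h, Nat.card_coe_set_eq, Set.ncard_coe_finset, Finset.card_map]

lemma shift_iterate_mem_spacingShift {P : Set ℕ} {x : ℕ → Bool} (hx : x ∈ SpacingShift P)
    (m : ℕ) : shift^[m] x ∈ SpacingShift P := by
  intro i j hij hi hj
  rw [shift_iterate_apply] at hi hj
  have := hx _ _ (by omega) hi hj
  rwa [Nat.add_sub_add_left] at this

lemma mem_spacingShift_of_imp {P : Set ℕ} {x z : ℕ → Bool} (hx : x ∈ SpacingShift P)
    (h : ∀ i, z i = true → x i = true) : z ∈ SpacingShift P :=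
  fun i j hij hi hj => hx i j hij (h i hi) (h j hj)

lemma isClosed_spacingShift (P : Set ℕ) : IsClosed (SpacingShift P) := by
  have h : SpacingShift P = ⋂ (i : ℕ) (j : ℕ) (_ : i < j ∧ j - i ∉ P),
      {x : ℕ → Bool | (x i && x j) = false} := by
    ext x
    simp only [SpacingShift, Set.mem_ofPred_eq, Set.mem_iInter, Bool.and_eq_false_iff]
    refine ⟨fun h i j hij => ?_, fun h i j hij hi hj => ?_⟩
    · by_contra! hc
      simp only [ne_eq, Bool.not_eq_false] at hc
      exact hij.2 (h i j hij.1 hc.1 hc.2)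
    · by_contra hP
      rcases h i j ⟨hij, hP⟩ with h | h <;> simp_all
  rw [h]
  refine isClosed_iInter fun i => isClosed_iInter fun j => isClosed_iInter fun _ => ?_
  have hand : Continuous fun p : Bool × Bool => p.1 && p.2 := continuous_of_discreteTopology
  have hij : Continuous fun x : ℕ → Bool => (x i, x j) := by fun_prop
  exact isClosed_eq (hand.comp hij) continuous_const

/-- The proportion of `supp x` in windows is bounded by one. -/
lemma window_density_le_one (x : ℕ → Bool) (n m : ℕ) :
    (Nat.card (supp x ∩ Set.Icc m (m + n) : Set ℕ) : ℝ) / (n + 1) ≤ 1 := by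
  rw [card_supp_inter_Icc, div_le_one (by positivity)]
  exact_mod_cast card_onesBelow_le _ _

lemma upperBanachDensity_pos_of_prefix_density {y : ℕ → Bool} {q : ℕ} (hq : 0 < q)
    (h : ∀ n, n ≤ q * (onesBelow y n).card) : 0 < upperBanachDensity (supp y) := by
  have hlow : ∀ n : ℕ, (1 / q : ℝ) ≤
      ⨆ m : ℕ, (Nat.card (supp y ∩ Set.Icc m (m + n) : Set ℕ) : ℝ) / (n + 1) := fun n => by
    refine le_ciSup_of_le ⟨1, Set.forall_mem_range.2 (window_density_le_one y n)⟩ 0 ?_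
    rw [card_supp_inter_Icc, Function.iterate_zero_apply, div_le_div_iff₀ (by positivity)
      (by positivity), one_mul, mul_comm]
    exact_mod_cast h (n + 1)
  have hq' : (0 : ℝ) < 1 / q := by positivity
  refine hq'.trans_le (le_limsup_of_frequently_le (Frequently.of_forall hlow) ?_)
  exact isBoundedUnder_of ⟨1, fun n => ciSup_le (window_density_le_one y n)⟩

lemma exists_upperBanachDensity_pos_of_prefixes {P : Set ℕ} {q : ℕ} (hq : 0 < q)
    (h : ∀ L, ∃ x ∈ SpacingShift P, ∀ n ≤ L, n ≤ q * (onesBelow x n).card) :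
    ∃ y ∈ SpacingShift P, 0 < upperBanachDensity (supp y) := by
  let K : ℕ → Set (ℕ → Bool) := fun L =>
    SpacingShift P ∩ ⋂ n, ⋂ (_ : n ≤ L), {x | n ≤ q * (onesBelow x n).card}
  have hclosed : ∀ L, IsClosed (K L) := fun L => (isClosed_spacingShift P).inter <|
    isClosed_iInter fun n => isClosed_iInter fun _ =>
      isClosed_le continuous_const (continuous_const.mul (continuous_card_onesBelow n))
  obtain ⟨y, hy⟩ := IsCompact.nonempty_iInter_of_sequence_nonempty_isCompact_isClosed K
    (fun L => Set.inter_subset_inter_right _ <|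
      Set.biInter_subset_biInter_left fun n (hn : n ≤ L) => Nat.le_succ_of_le hn)
    (fun L => by
      obtain ⟨x, hx, hxL⟩ := h L
      exact ⟨x, hx, Set.mem_iInter₂.2 hxL⟩)
    (hclosed 0).isCompact hclosed
  rw [Set.mem_iInter] at hy
  refine ⟨y, (hy 0).1, upperBanachDensity_pos_of_prefix_density hq fun n => ?_⟩
  exact Set.mem_iInter₂.1 (hy n).2 n le_rfl

/-- If every point has a sparse prefix of bounded length, then all prefixes are sparse, up to an
additive constant. -/
lemma card_onesBelow_le_of_sparse_prefix {P : Set ℕ} {q L : ℕ}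
    (h : ∀ x ∈ SpacingShift P, ∃ n ≤ L, q * (onesBelow x n).card < n) (N : ℕ) :
    ∀ x ∈ SpacingShift P, q * (onesBelow x N).card ≤ N + q * L := by
  induction N using Nat.strong_induction_on with
  | _ N ih =>
    intro x hx
    obtain ⟨n, hnL, hn⟩ := h x hx
    rcases le_total N L with hN | hN
    · exact (Nat.mul_le_mul_left q ((card_onesBelow_le x N).trans hN)).trans (Nat.le_add_left _ _)
    · have hrec := ih (N - n) (by omega) _ (shift_iterate_mem_spacingShift hx n)
      have hadd := card_onesBelow_add x n (N - n)
      rw [Nat.add_sub_cancel' (hnL.trans hN)] at hadd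
      rw [hadd, mul_add]
      omega

/-- There are few sparse subsets of `{0, …, N - 1}`. -/
lemma card_sparse_subsets_le {a : ℝ} (ha : 0 < a) {q : ℕ} (hq : 1 ≤ a * (1 + a) ^ q) (N C : ℕ) :
    ((({S ∈ (Finset.range N).powerset | q * S.card ≤ N + C} : Finset (Finset ℕ)).card : ℕ) : ℝ) ≤
      (1 + a) ^ (2 * N + C) := by
  have hsum : ∑ S ∈ (Finset.range N).powerset, a ^ S.card = (1 + a) ^ N := by
    have := Finset.sum_pow_mul_eq_add_pow a 1 (Finset.range N)
    simpa [add_comm] using this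
  calc ((({S ∈ (Finset.range N).powerset | q * S.card ≤ N + C} : Finset (Finset ℕ)).card : ℕ) : ℝ)
      = ∑ S ∈ (Finset.range N).powerset with q * S.card ≤ N + C, (1 : ℝ) := by simp
    _ ≤ ∑ S ∈ (Finset.range N).powerset with q * S.card ≤ N + C,
        a ^ S.card * (1 + a) ^ (N + C) := by
      refine Finset.sum_le_sum fun S hS => ?_
      have hS := (Finset.mem_filter.1 hS).2
      calc (1 : ℝ) ≤ (a * (1 + a) ^ q) ^ S.card := one_le_pow₀ hq
        _ = a ^ S.card * (1 + a) ^ (q * S.card) := by rw [mul_pow, pow_mul]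
        _ ≤ _ := by
          gcongr
          linarith
    _ ≤ ∑ S ∈ (Finset.range N).powerset, a ^ S.card * (1 + a) ^ (N + C) :=
      Finset.sum_le_sum_of_subset_of_nonneg (Finset.filter_subset _ _) fun _ _ _ => by positivity
    _ = (1 + a) ^ (2 * N + C) := by
      rw [← Finset.sum_mul, hsum, ← pow_add]
      congr 1
      ring

lemma exists_cylinder_subset {U : SetRel (ℕ → Bool) (ℕ → Bool)} (hU : U ∈ uniformity (ℕ → Bool)) :
    ∃ k, ∀ x y : ℕ → Bool, (∀ i < k, x i = y i) → (x, y) ∈ U := by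
  rw [Pi.uniformity, Filter.mem_iInf] at hU
  obtain ⟨I, hI, V, hV, rfl⟩ := hU
  obtain ⟨b, hb⟩ := hI.bddAbove
  refine ⟨b + 1, fun x y hxy => Set.mem_iInter.2 fun i => ?_⟩
  obtain ⟨W, hW, hWV⟩ := Filter.mem_comap.1 (hV i)
  refine hWV ?_
  have : x i = y i := hxy i (Nat.lt_succ_of_le (hb i.2))
  simp only [Set.mem_preimage, this]
  exact refl_mem_uniformity hW

lemma coverMincard_le_card_sparse_subsets {P : Set ℕ} {q C k : ℕ}
    (h : ∀ N, ∀ x ∈ SpacingShift P, q * (onesBelow x N).card ≤ N + C)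
    {U : SetRel (ℕ → Bool) (ℕ → Bool)}
    (hk : ∀ x y : ℕ → Bool, (∀ i < k, x i = y i) → (x, y) ∈ U) (n : ℕ) :
    Dynamics.coverMincard shift (SpacingShift P) U n ≤
      (({S ∈ (Finset.range (n + k)).powerset | q * S.card ≤ n + k + C} :
        Finset (Finset ℕ)).card : ℕ∞) := by
  classical
  set 𝒮 : Finset (Finset ℕ) := {S ∈ (Finset.range (n + k)).powerset | q * S.card ≤ n + k + C}
  have hcover : Dynamics.IsDynCoverOf shift (SpacingShift P) U n
      (𝒮.image fun S i => decide (i ∈ S) : Finset (ℕ → Bool)) := by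
    intro x hx
    refine ⟨fun i => decide (i ∈ onesBelow x (n + k)), ?_, ?_⟩
    · refine Finset.mem_coe.2 (Finset.mem_image_of_mem _ ?_)
      exact Finset.mem_filter.2 ⟨Finset.mem_powerset.2 (Finset.filter_subset _ _), h _ x hx⟩
    · refine Dynamics.mem_dynEntourage.2 fun m hm => hk _ _ fun i hi => ?_
      simp [shift_iterate_apply, mem_onesBelow, show m + i < n + k by omega]
  exact hcover.coverMincard_le_card.trans (by exact_mod_cast Finset.card_image_le)

lemma coverEntropy_le_of_sparse {P : Set ℕ} {a : ℝ} (ha : 0 < a) {q C : ℕ}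
    (hq : 1 ≤ a * (1 + a) ^ q)
    (h : ∀ N, ∀ x ∈ SpacingShift P, q * (onesBelow x N).card ≤ N + C) :
    Dynamics.coverEntropy shift (SpacingShift P) ≤ ((3 * a : ℝ) : EReal) := by
  refine iSup₂_le fun U hU => ?_
  obtain ⟨k, hk⟩ := exists_cylinder_subset hU
  refine Eventually.expGrowthSup_le ?_
  filter_upwards [eventually_ge_atTop (2 * k + C)] with n hn
  have hcard := (card_sparse_subsets_le ha hq (n + k) C).trans <|
    calc (1 + a) ^ (2 * (n + k) + C) ≤ (1 + a) ^ (3 * n) :=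
          pow_le_pow_right₀ (by linarith) (by omega)
      _ ≤ Real.exp a ^ (3 * n) := by
          gcongr
          linarith [Real.add_one_le_exp a]
      _ = Real.exp (3 * a * n) := by
          rw [← Real.exp_nat_mul]
          push_cast
          ring_nf
  have hexp : EReal.exp (((3 * a : ℝ) : EReal) * n) = ENNReal.ofReal (Real.exp (3 * a * n)) := by
    rw [← EReal.exp_coe]
    norm_cast
  rw [hexp]
  refine (ENat.toENNReal_mono (coverMincard_le_card_sparse_subsets h hk n)).trans ?_
  rw [ENat.toENNReal_coe]
  refine ENNReal.le_ofReal_iff_toReal_le (ENNReal.natCast_ne_top _) (Real.exp_pos _).le |>.2 ?_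
  rwa [ENNReal.toReal_natCast]

lemma coverEntropy_nonpos_of_forall_upperBanachDensity_nonpos {P : Set ℕ}
    (h : ¬ ∃ y ∈ SpacingShift P, 0 < upperBanachDensity (supp y)) :
    Dynamics.coverEntropy shift (SpacingShift P) ≤ 0 := by
  refine EReal.le_of_forall_lt_iff_le.1 fun z hz => ?_
  have ha : 0 < z / 3 := div_pos (by exact_mod_cast hz) (by norm_num)
  obtain ⟨q, hq⟩ := pow_unbounded_of_one_lt (z / 3)⁻¹ (show 1 < 1 + z / 3 by linarith)
  have hq1 : 1 ≤ z / 3 * (1 + z / 3) ^ (q + 1) := by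
    have : (1 + z / 3) ^ q ≤ (1 + z / 3) ^ (q + 1) :=
      pow_le_pow_right₀ (by linarith) (Nat.le_succ q)
    exact (mul_inv_cancel₀ ha.ne').symm.trans_le
      (mul_le_mul_of_nonneg_left (hq.le.trans this) ha.le)
  have hsparse : ∃ L, ∀ x ∈ SpacingShift P, ∃ n ≤ L, (q + 1) * (onesBelow x n).card < n := by
    by_contra! hc
    exact h (exists_upperBanachDensity_pos_of_prefixes q.succ_pos hc)
  obtain ⟨L, hL⟩ := hsparse
  have := coverEntropy_le_of_sparse ha hq1 (card_onesBelow_le_of_sparse_prefix hL)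
  rwa [mul_div_cancel₀ z (by norm_num : (3 : ℝ) ≠ 0)] at this

/-- The entourage of pairs of sequences agreeing at the origin. -/
def originEntourage : SetRel (ℕ → Bool) (ℕ → Bool) := {p | p.1 0 = p.2 0}

lemma originEntourage_mem_uniformity : originEntourage ∈ uniformity (ℕ → Bool) := by
  have h : {p : Bool × Bool | p.1 = p.2} ∈ uniformity Bool := by
    rw [discreteUniformity_iff_eq_principal_setRelId.1 inferInstance]
    exact Filter.mem_principal.2 fun p hp => hp
  exact Pi.uniformContinuous_proj (fun _ : ℕ => Bool) 0 h

/-- Erasing ones from a point yields a separated family indexed by sets of ones. -/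
lemma two_pow_card_onesBelow_le_netMaxcard {P : Set ℕ} {x : ℕ → Bool} (hx : x ∈ SpacingShift P)
    (N : ℕ) : ((2 ^ (onesBelow x N).card : ℕ) : ℕ∞) ≤
      Dynamics.netMaxcard shift (SpacingShift P) originEntourage N := by
  classical
  let f : Finset ℕ → ℕ → Bool := fun S i => decide (i ∈ S)
  have hf : Function.Injective f := fun S T hST => by
    ext i
    simpa [f] using congrFun hST i
  have hnet : Dynamics.IsDynNetIn shift (SpacingShift P) originEntourage N
      ((onesBelow x N).powerset.image f : Finset (ℕ → Bool)) := by
    constructor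
    · intro z hz
      obtain ⟨S, hS, rfl⟩ := Finset.mem_image.1 (Finset.mem_coe.1 hz)
      refine mem_spacingShift_of_imp hx fun i hi => ?_
      exact (mem_onesBelow.1 (Finset.mem_powerset.1 hS (by simpa [f] using hi))).2
    · intro z hz w hw hzw
      obtain ⟨S, hS, rfl⟩ := Finset.mem_image.1 (Finset.mem_coe.1 hz)
      obtain ⟨T, hT, rfl⟩ := Finset.mem_image.1 (Finset.mem_coe.1 hw)
      refine Set.disjoint_left.2 fun v hv hv' => hzw ?_
      have hv := Dynamics.mem_dynEntourage.1 hv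
      have hv' := Dynamics.mem_dynEntourage.1 hv'
      funext i
      by_cases hi : i < N
      · have h₁ : f S i = v i := by simpa [originEntourage, shift_iterate_apply] using hv i hi
        have h₂ : f T i = v i := by simpa [originEntourage, shift_iterate_apply] using hv' i hi
        rw [h₁, h₂]
      · have h₀ : ∀ R ∈ (onesBelow x N).powerset, i ∉ R := fun R hR hiR =>
          hi (mem_onesBelow.1 (Finset.mem_powerset.1 hR hiR)).1
        simp [f, h₀ S hS, h₀ T hT]
  have := hnet.card_le_netMaxcard
  rwa [Finset.card_image_of_injective _ hf, Finset.card_powerset] at this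

lemma coverEntropy_pos_of_upperBanachDensity_pos {P : Set ℕ} {y : ℕ → Bool}
    (hy : y ∈ SpacingShift P) (hpos : 0 < upperBanachDensity (supp y)) :
    0 < Dynamics.coverEntropy shift (SpacingShift P) := by
  obtain ⟨c, hc, hcd⟩ := exists_between hpos
  have hfreq := frequently_lt_of_lt_limsup
    (isCoboundedUnder_le_of_le atTop (x := 0) fun n => Real.iSup_nonneg fun m => by positivity) hcd
  have hclog : (0 : EReal) < ((c * Real.log 2 : ℝ) : EReal) := by
    exact_mod_cast mul_pos hc (Real.log_pos one_lt_two)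
  refine hclog.trans_le (le_trans ?_
    (Dynamics.netEntropyEntourage_le_coverEntropy _ _ originEntourage_mem_uniformity))
  refine Frequently.le_expGrowthSup ((tendsto_add_atTop_nat 1).frequently (hfreq.mono ?_))
  intro n hn
  obtain ⟨m, hm⟩ := exists_lt_of_lt_ciSup hn
  rw [card_supp_inter_Icc, lt_div_iff₀ (by positivity)] at hm
  have hnet := ENat.toENNReal_mono <| two_pow_card_onesBelow_le_netMaxcard
    (shift_iterate_mem_spacingShift hy m) (n + 1)
  refine le_trans ?_ hnet
  have hexp : EReal.exp (((c * Real.log 2 : ℝ) : EReal) * (n + 1 : ℕ)) =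
      ENNReal.ofReal (Real.exp (c * Real.log 2 * (n + 1 : ℕ))) := by
    rw [← EReal.exp_coe]
    norm_cast
  rw [hexp, ENat.toENNReal_coe]
  refine ENNReal.ofReal_le_of_le_toReal ?_
  rw [ENNReal.toReal_natCast, Nat.cast_pow, Nat.cast_ofNat, ← Real.exp_log (pow_pos two_pos _),
    Real.log_pow]
  refine Real.exp_le_exp.2 ?_
  have := mul_le_mul_of_nonneg_right hm.le (Real.log_pos one_lt_two).le
  push_cast
  linarith

/-- There is `y ∈ Σ_P` with `d*(y) > 0` iff `h_{σ_P} > 0`. -/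
theorem pos_banachDensity_iff_pos_entropy (P : Set ℕ) :
    (∃ y ∈ SpacingShift P, 0 < upperBanachDensity (supp y)) ↔
      0 < Dynamics.coverEntropy shift (SpacingShift P) := by
  refine ⟨fun ⟨y, hy, hpos⟩ => coverEntropy_pos_of_upperBanachDensity_pos hy hpos, fun h => ?_⟩
  by_contra hc
  exact h.not_ge (coverEntropy_nonpos_of_forall_upperBanachDensity_nonpos hc)
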